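/- For all natural numbers m, n with m ≥ 3 and n ≥ 3, except for the cases {m, n} = {3, 3} and {m, n} = {3, 5} (i.e., excluding (m,n) = (3,3), (3,5) and (5,3)), the star chromatic number of the Cartesian product Cm □ Cn equals 5; that is, Cm □ Cn admits a star coloring with 5 colors, and every star coloring of Cm □ Cn uses at least 5 colors. -/

import Mathlib

/-- A star coloring of `G` with `k` colors: a proper vertex coloring such that
no path on 4 vertices is bicolored. -/
def IsStarColoring {V : Type*} (G : SimpleGraph V) {k : ℕ} (c : V → Fin k) : Prop :=
  (∀ u v : V, G.Adj u v → c u ≠ c v) ∧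
  ¬ ∃ v1 v2 v3 v4 : V,
      v1 ≠ v2 ∧ v1 ≠ v3 ∧ v1 ≠ v4 ∧ v2 ≠ v3 ∧ v2 ≠ v4 ∧ v3 ≠ v4 ∧
      G.Adj v1 v2 ∧ G.Adj v2 v3 ∧ G.Adj v3 v4 ∧ c v1 = c v3 ∧ c v2 = c v4

/-- Successors in the graph obtained by concatenating intervals of `ℕ` in an arbitrary order:
`starts` lists the first elements of the intervals and `lasts` their last elements. -/
def blockNext (starts lasts : List ℕ) (a : ℕ) : List ℕ :=
  if a ∈ lasts then starts else [a + 1]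

/-- The part of the local star coloring condition of `col` on a product of two digraphs, given by
successor lists `s` and `t` on `{0, …, M - 1}` and `{0, …, N - 1}`, that concerns paths on 4
vertices with at least two steps along `s`, or four vertices of a square. -/
def LocallyStar (s t : ℕ → List ℕ) (M N : ℕ) (col : ℕ → ℕ → Fin 5) : Prop :=
  ∀ a < M, ∀ b ∈ s a, ∀ c ∈ s b, ∀ p < N,
    col a p ≠ col b p ∧
    (∀ d ∈ s c, ¬(col a p = col c p ∧ col b p = col d p)) ∧
    ∀ q ∈ t p,
      ¬(col a p = col b q ∧ col a q = col b p) ∧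
      ¬(col a p = col c p ∧ col b p = col c q) ∧
      ¬(col a p = col c p ∧ col b p = col a q) ∧
      ¬(col a q = col c q ∧ col b q = col c p) ∧
      ¬(col a q = col c q ∧ col b q = col a p) ∧
      ¬(col a p = col b q ∧ col b p = col c q) ∧
      ¬(col a q = col b p ∧ col b q = col c p)

instance (s t : ℕ → List ℕ) (M N : ℕ) (col : ℕ → ℕ → Fin 5) :
    Decidable (LocallyStar s t M N col) := by
  unfold LocallyStar; infer_instance

/-- The coloring of `ℕ × ℕ` whose `a`-th row is given by the decimal digits of `rows[a]`, the least
significant digit first. -/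
def digitColoring (rows : List ℕ) (a b : ℕ) : Fin 5 :=
  Fin.ofNat 5 (rows.getD a 0 / 10 ^ b)

theorem cycleGraph_adj_iff {m : ℕ} {u v : Fin (m + 2)} :
    (SimpleGraph.cycleGraph (m + 2)).Adj u v ↔ v = u + 1 ∨ u = v + 1 := by
  rw [SimpleGraph.cycleGraph_adj, sub_eq_iff_eq_add', sub_eq_iff_eq_add', or_comm,
    add_comm u, add_comm v]


set_option maxHeartbeats 1000000 in
/-- A locally star coloring pulls back along closed walks to a star coloring of a torus. -/
theorem LocallyStar.isStarColoring {s t : ℕ → List ℕ} {M N : ℕ} {col : ℕ → ℕ → Fin 5}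
    (h₁ : LocallyStar s t M N col) (h₂ : LocallyStar t s N M fun y x => col x y)
    {m n : ℕ} {w : Fin (m + 2) → ℕ} {z : Fin (n + 2) → ℕ}
    (hwM : ∀ i, w i < M) (hw : ∀ i, w (i + 1) ∈ s (w i))
    (hzN : ∀ i, z i < N) (hz : ∀ i, z (i + 1) ∈ t (z i)) :
    IsStarColoring ((SimpleGraph.cycleGraph (m + 2)).boxProd (SimpleGraph.cycleGraph (n + 2)))
      fun x => col (w x.1) (z x.2) := by
  have H₁ := fun i j => h₁ _ (hwM i) _ (hw i) _ (hw (i + 1)) _ (hzN j)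
  have H₂ := fun i j => h₂ _ (hzN j) _ (hz j) _ (hz (j + 1)) _ (hwM i)
  have E₁ := fun i j => (H₁ i j).1
  have E₂ := fun i j => (H₂ i j).1
  have S₁ := fun i j => (H₁ i j).2.1 _ (hw (i + 1 + 1))
  have S₂ := fun i j => (H₂ i j).2.1 _ (hz (j + 1 + 1))
  have T₁ := fun i j => (H₁ i j).2.2 _ (hz j)
  have T₂ := fun i j => (H₂ i j).2.2 _ (hw i)
  clear h₁ h₂ H₁ H₂ hwM hw hzN hz
  generalize hf : (fun i j => col (w i) (z j)) = f
  replace hf : ∀ i j, col (w i) (z j) = f i j := fun i j => by rw [← hf]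
  simp only [hf] at *
  refine ⟨?_, ?_⟩
  · rintro ⟨i, j⟩ ⟨i', j'⟩ h
    simp only [SimpleGraph.boxProd_adj, cycleGraph_adj_iff] at h
    rcases h with ⟨rfl | rfl, rfl⟩ | ⟨rfl | rfl, rfl⟩
    exacts [E₁ _ _, (E₁ _ _).symm, E₂ _ _, (E₂ _ _).symm]
  · rintro ⟨⟨i₁, j₁⟩, ⟨i₂, j₂⟩, ⟨i₃, j₃⟩, ⟨i₄, j₄⟩, -, h₁₃, -, -, h₂₄, -, a, b, c, e, e'⟩
    simp only [SimpleGraph.boxProd_adj, cycleGraph_adj_iff, ne_eq, Prod.mk.injEq] at *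
    rcases b with ⟨rfl | rfl, rfl⟩ | ⟨rfl | rfl, rfl⟩ <;>
    rcases a with ⟨a | a, rfl⟩ | ⟨a | a, rfl⟩ <;>
    rcases c with ⟨c | c, rfl⟩ | ⟨c | c, rfl⟩ <;>
    (try rw [add_left_inj] at a) <;> subst a <;>
    (try rw [add_left_inj] at c) <;> subst c <;>
    grind

/-- Closed walks formed by `q` copies of the first block `{0, 1, 2, 3}` and a single block
`{b, …, b + L - 1}`. -/
theorem exists_closed_walk {starts lasts : List ℕ} {M b L : ℕ} (q : ℕ) (h4 : 4 ≤ M)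
    (hbM : b + L ≤ M) (h0 : 0 ∈ starts) (hb : b ∈ starts)
    (h3 : ∀ i < 4, i ∈ lasts ↔ i = 3)
    (hL : ∀ i < L, b + i ∈ lasts ↔ i + 1 = L) {n : ℕ} (hn : n + 2 = 4 * q + L) (hL0 : 0 < L) :
    ∃ w : Fin (n + 2) → ℕ, (∀ i, w i < M) ∧ ∀ i, w (i + 1) ∈ blockNext starts lasts (w i) := by
  let w : ℕ → ℕ := fun i => if i < 4 * q then i % 4 else b + (i - 4 * q)
  refine ⟨fun i => w i, fun i => ?_, fun i => ?_⟩
  · have := i.2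
    simp only [w]
    split_ifs <;> omega
  · have hi := i.2
    have hwi : w i ∈ lasts ↔ (i.1 < 4 * q ∧ i.1 % 4 = 3) ∨ i.1 + 1 = n + 2 := by
      simp only [w]
      split_ifs with h
      · rw [h3 _ (by omega)]; omega
      · rw [hL _ (by omega)]; omega
    have hv : (i + 1).1 = if i.1 + 1 = n + 2 then 0 else i.1 + 1 := by
      rw [Fin.val_add_one]
      simp [Fin.ext_iff]
    have hw0 : w 0 ∈ starts := by
      simp only [w]
      split_ifs <;> simpa
    simp only [blockNext, hv]
    split_ifs with h₂ h₁ h₁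
    · exact hw0
    · have : w (i.1 + 1) = 0 ∨ w (i.1 + 1) = b := by
        have := hwi.1 h₂
        simp only [w]
        split_ifs <;> omega
      rcases this with h | h <;> rwa [h]
    · exact absurd (hwi.2 (.inr h₁)) h₂
    · have := mt hwi.2 h₂
      simp only [w, List.mem_singleton]
      split_ifs <;> omega

/-- A coloring of the squares of blocks with side lengths 4, 5, 6 and 7. -/
def squareRows : List ℕ :=
  [4101301403410432104010,
    1342432312302314021302,
    410314034134043410141,
    1243243121023120231203,
    4104120413210432104310,
    2031034201434204342034,
    3423401432041321014321,
    310312014324043120142,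
    1243243121043120431203,
    4031401403210432104310,
    120132010432104321032,
    3431241342010320103241,
    2104104210304213042104,
    320312034121041210312,
    1243243121043120431243,
    4101401403210432104010,
    1324312314302314021302,
    210143032143021340143,
    2431231420421240213421,
    3104104312304313042304,
    320312034132042120132,
    1243243121043120431243]

theorem locallyStar_squareRows :
    LocallyStar (blockNext [0, 4, 9, 15] [3, 8, 14, 21]) (blockNext [0, 4, 9, 15] [3, 8, 14, 21])
      22 22 (digitColoring squareRows) := by
  decide +kernel

theorem locallyStar_squareRows_swap :
    LocallyStar (blockNext [0, 4, 9, 15] [3, 8, 14, 21]) (blockNext [0, 4, 9, 15] [3, 8, 14, 21])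
      22 22 (fun y x => digitColoring squareRows x y) := by
  decide +kernel

/-- A coloring of the blocks of height 3 and widths 4, 6, 7 and 9. -/
def triangleRows : List ℕ :=
  [24310234120143013023013031,
    40243102341321234134234323,
    31032421032402402401402140]

theorem locallyStar_triangleRows :
    LocallyStar (blockNext [0] [2]) (blockNext [0, 4, 10, 17] [3, 9, 16, 25])
      3 26 (digitColoring triangleRows) := by
  decide +kernel

theorem locallyStar_triangleRows_swap :
    LocallyStar (blockNext [0, 4, 10, 17] [3, 9, 16, 25]) (blockNext [0] [2])
      26 3 (fun y x => digitColoring triangleRows x y) := by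
  decide +kernel

/-- The neighbors of the vertex `s` in the 4 × 4 grid, numbered row by row. -/
def gridNbrs (s : ℕ) : List ℕ :=
  (if s % 4 = 0 then [] else [s - 1]) ++ (if s % 4 = 3 then [] else [s + 1]) ++
    (if s < 4 then [] else [s - 4]) ++ (if 12 ≤ s then [] else [s + 4])

/-- Whether the last vertex of the partial coloring `l` of the 4 × 4 grid is adjacent to a vertex
of the same color or lies on a bicolored path on 4 vertices. -/
def conflict (l : List ℕ) (t : ℕ) : Bool :=
  let c := fun s => l.getD s 0
  let N := fun s => (gridNbrs s).filter (· ≤ t)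
  (N t).any fun u => c u == c t ||
    ((N u).any fun v => v != t && c v == c t && (N v).any fun x => x != u && c x == c u) ||
    (N t).any fun v => v != u && c v == c u && (N v).any fun x => x != t && c x == c t

/-- Whether no coloring of the 4 × 4 grid with 4 colors that extends the coloring `l` of the first
`t` vertices can be found by adding at most `fuel` vertices. -/
def refutes : ℕ → List ℕ → ℕ → Bool
  | 0, _, _ => false
  | fuel + 1, l, t => (List.range 4).all fun c =>
      conflict (l ++ [c]) t || refutes fuel (l ++ [c]) (t + 1)

theorem conflict_eq_false {g : ℕ → ℕ} (hadj : ∀ a < 16, ∀ b ∈ gridNbrs a, g b ≠ g a)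
    (hstar : ∀ a < 16, ∀ b ∈ gridNbrs a, ∀ c ∈ gridNbrs b, ∀ d ∈ gridNbrs c,
      c ≠ a → d ≠ b → g c = g a → g d ≠ g b) {t : ℕ} (ht : t < 16) :
    conflict ((List.range (t + 1)).map g) t = false := by
  have hget : ∀ s ≤ t, ((List.range (t + 1)).map g).getD s 0 = g s := fun s hs => by
    simp [List.getD, Nat.lt_succ_of_le hs]
  have hsymm : ∀ a < 16, ∀ b ∈ gridNbrs a, a ∈ gridNbrs b ∧ b < 16 := by decide +kernel
  rw [Bool.eq_false_iff]
  intro h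
  simp only [conflict, List.any_eq_true, List.mem_filter, Bool.or_eq_true, Bool.and_eq_true,
    decide_eq_true_eq, beq_iff_eq, bne_iff_ne] at h
  obtain ⟨u, ⟨hu, hut⟩, (h | ⟨v, ⟨hv, hvt⟩, ⟨hne, h⟩, x, ⟨hx, hxt⟩, hne', h'⟩) |
    ⟨v, ⟨hv, hvt⟩, ⟨hne, h⟩, x, ⟨hx, hxt⟩, hne', h'⟩⟩ := h
  · rw [hget _ hut, hget _ le_rfl] at h
    exact hadj _ ht _ hu h
  · rw [hget _ hvt, hget _ le_rfl] at h
    rw [hget _ hxt, hget _ hut] at h'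
    exact hstar _ ht _ hu _ hv _ hx hne hne' h h'
  · rw [hget _ hvt, hget _ hut] at h
    rw [hget _ hxt, hget _ le_rfl] at h'
    exact hstar _ (hsymm _ ht _ hu).2 _ (hsymm _ ht _ hu).1 _ hv _ hx hne hne' h h'

theorem refutes_eq_false {g : ℕ → ℕ} (hg : ∀ s, g s < 4)
    (hadj : ∀ a < 16, ∀ b ∈ gridNbrs a, g b ≠ g a)
    (hstar : ∀ a < 16, ∀ b ∈ gridNbrs a, ∀ c ∈ gridNbrs b, ∀ d ∈ gridNbrs c,
      c ≠ a → d ≠ b → g c = g a → g d ≠ g b) (fuel t : ℕ) (ht : fuel + t ≤ 16) :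
    refutes fuel ((List.range t).map g) t = false := by
  induction fuel generalizing t with
  | zero => rfl
  | succ fuel ih =>
    rw [refutes, List.all_eq_false]
    refine ⟨g t, by simpa using hg t, ?_⟩
    have h : (List.range t).map g ++ [g t] = (List.range (t + 1)).map g := by
      simp [List.range_succ]
    rw [h, conflict_eq_false hadj hstar (by omega), ih _ (by omega)]
    simp

theorem refutes_grid : refutes 14 [0, 1] 2 = true := by
  decide +kernel

theorem ofNat_fin_add_one (m a : ℕ) : Fin.ofNat (m + 3) (a + 1) = Fin.ofNat (m + 3) a + 1 := by
  ext
  simp [Fin.val_add]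

theorem ofNat_fin_ne {m a b : ℕ} (h : a ≠ b) (h₁ : a < b + (m + 3)) (h₂ : b < a + (m + 3)) :
    Fin.ofNat (m + 3) a ≠ Fin.ofNat (m + 3) b := by
  intro e
  have e := congrArg Fin.val e
  rw [Fin.val_ofNat, Fin.val_ofNat] at e
  have := Int.eq_zero_of_abs_lt_dvd (Nat.modEq_iff_dvd.1 e) (by push_cast; rw [abs_lt]; omega)
  omega

/-- A torus has no star coloring with fewer than 5 colors, since a 4 × 4 grid has none. -/
theorem IsStarColoring.five_le {m n k : ℕ} {c : Fin (m + 3) × Fin (n + 3) → Fin k}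
    (h : IsStarColoring
      ((SimpleGraph.cycleGraph (m + 3)).boxProd (SimpleGraph.cycleGraph (n + 3))) c) :
    5 ≤ k := by
  by_contra! hk
  let φ : ℕ → Fin (m + 3) × Fin (n + 3) := fun s => (Fin.ofNat _ (s / 4), Fin.ofNat _ (s % 4))
  have hnbr : ∀ a < 16, ∀ b ∈ gridNbrs a,
      b < 16 ∧ (b / 4 = a / 4 ∧ (b % 4 = a % 4 + 1 ∨ a % 4 = b % 4 + 1) ∨
        b % 4 = a % 4 ∧ (b / 4 = a / 4 + 1 ∨ a / 4 = b / 4 + 1)) := by decide +kernel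
  have hφ : ∀ a < 16, ∀ b ∈ gridNbrs a,
      ((SimpleGraph.cycleGraph (m + 3)).boxProd (SimpleGraph.cycleGraph (n + 3))).Adj
        (φ a) (φ b) := by
    intro a ha b hb
    simp only [SimpleGraph.boxProd_adj, cycleGraph_adj_iff, φ]
    obtain ⟨-, ⟨e, e' | e'⟩ | ⟨e, e' | e'⟩⟩ := hnbr a ha b hb <;>
      simp [e, e', ofNat_fin_add_one, -Fin.ofNat_eq_cast]
  have hne : ∀ a < 16, ∀ b ∈ gridNbrs a, ∀ d ∈ gridNbrs b, d ≠ a → φ a ≠ φ d := by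
    intro a ha b hb d hd hda e
    have h₁ := hnbr a ha b hb
    have h₂ := hnbr b h₁.1 d hd
    simp only [φ, Prod.mk.injEq] at e
    by_cases hq : a / 4 = d / 4
    · exact ofNat_fin_ne (m := n) (a := a % 4) (b := d % 4) (by omega) (by omega) (by omega) e.2
    · exact ofNat_fin_ne hq (by omega) (by omega) e.1
  obtain ⟨σ, hσ, hσ₀, hσ₁⟩ : ∃ σ : Fin k → Fin 4,
      Function.Injective σ ∧ σ (c (φ 0)) = 0 ∧ σ (c (φ 1)) = 1 := by
    have h01 : Fin.castLE (Nat.le_of_lt_succ hk) (c (φ 0)) ≠ Fin.castLE _ (c (φ 1)) :=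
      (Fin.castLE_injective _).ne (h.1 _ _ (hφ 0 (by decide) 1 (by decide)))
    obtain ⟨τ, h₀, h₁⟩ := (show ∀ x y : Fin 4, x ≠ y → ∃ τ : Equiv.Perm (Fin 4),
      τ x = 0 ∧ τ y = 1 by decide +kernel) _ _ h01
    exact ⟨τ ∘ Fin.castLE _, τ.injective.comp (Fin.castLE_injective _), h₀, h₁⟩
  have hval : ∀ a b, (σ (c (φ a))).1 = (σ (c (φ b))).1 → c (φ a) = c (φ b) := fun a b e =>
    hσ (Fin.ext e)
  have hproper : ∀ a < 16, ∀ b ∈ gridNbrs a, (σ (c (φ b))).1 ≠ (σ (c (φ a))).1 :=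
    fun a ha b hb e => h.1 _ _ (hφ a ha b hb) (hval _ _ e).symm
  have := refutes_eq_false (g := fun s => (σ (c (φ s))).1) (fun s => by omega) hproper
    (fun a ha b hb d hd x hx hda hxb e e' => by
      have hb16 := (hnbr a ha b hb).1
      have hd16 := (hnbr b hb16 d hd).1
      refine h.2 ⟨φ a, φ b, φ d, φ x, (hφ a ha b hb).ne, hne a ha b hb d hd hda, ?_,
        (hφ b hb16 d hd).ne, hne b hb16 d hd x hx hxb, (hφ d hd16 x hx).ne,
        hφ a ha b hb, hφ b hb16 d hd, hφ d hd16 x hx, (hval _ _ e).symm, (hval _ _ e').symm⟩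
      intro h'
      rw [← h'] at e'
      exact hproper a ha b hb e'.symm) 14 2 (by norm_num)
  simp [List.range_succ, hσ₀, hσ₁, refutes_grid] at this

/-- A star coloring of a graph yields one of every isomorphic graph. -/
theorem IsStarColoring.comp_iso {V W : Type*} {G : SimpleGraph V} {H : SimpleGraph W} {k : ℕ}
    {c : W → Fin k} (h : IsStarColoring H c) (e : G ≃g H) : IsStarColoring G (c ∘ e) := by
  refine ⟨fun u v huv => h.1 _ _ (e.map_adj_iff.2 huv), ?_⟩
  rintro ⟨v₁, v₂, v₃, v₄, h₁₂, h₁₃, h₁₄, h₂₃, h₂₄, h₃₄, a, b, d, hc⟩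
  exact h.2 ⟨e v₁, e v₂, e v₃, e v₄, e.injective.ne h₁₂, e.injective.ne h₁₃, e.injective.ne h₁₄,
    e.injective.ne h₂₃, e.injective.ne h₂₄, e.injective.ne h₃₄, e.map_adj_iff.2 a,
    e.map_adj_iff.2 b, e.map_adj_iff.2 d, hc⟩

theorem exists_closed_walk_square {n : ℕ} (hn : 4 ≤ n + 2) :
    ∃ w : Fin (n + 2) → ℕ, (∀ i, w i < 22) ∧
      ∀ i, w (i + 1) ∈ blockNext [0, 4, 9, 15] [3, 8, 14, 21] (w i) := by
  have h : (n + 2) % 4 < 4 := Nat.mod_lt _ (by norm_num)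
  interval_cases hr : (n + 2) % 4
  · exact exists_closed_walk (b := 0) (L := 4) ((n + 2) / 4 - 1) (by decide) (by decide)
      (by decide) (by decide) (by decide) (by decide) (by omega) (by decide)
  · exact exists_closed_walk (b := 4) (L := 5) ((n + 2) / 4 - 1) (by decide) (by decide)
      (by decide) (by decide) (by decide) (by decide) (by omega) (by decide)
  · exact exists_closed_walk (b := 9) (L := 6) ((n + 2) / 4 - 1) (by decide) (by decide)
      (by decide) (by decide) (by decide) (by decide) (by omega) (by decide)
  · exact exists_closed_walk (b := 15) (L := 7) ((n + 2) / 4 - 1) (by decide) (by decide)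
      (by decide) (by decide) (by decide) (by decide) (by omega) (by decide)

theorem exists_closed_walk_triangle {n : ℕ} (hn : 4 ≤ n + 2) (hn5 : n + 2 ≠ 5) :
    ∃ w : Fin (n + 2) → ℕ, (∀ i, w i < 26) ∧
      ∀ i, w (i + 1) ∈ blockNext [0, 4, 10, 17] [3, 9, 16, 25] (w i) := by
  have h : (n + 2) % 4 < 4 := Nat.mod_lt _ (by norm_num)
  interval_cases hr : (n + 2) % 4
  · exact exists_closed_walk (b := 0) (L := 4) ((n + 2) / 4 - 1) (by decide) (by decide)
      (by decide) (by decide) (by decide) (by decide) (by omega) (by decide)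
  · exact exists_closed_walk (b := 17) (L := 9) ((n + 2) / 4 - 2) (by decide) (by decide)
      (by decide) (by decide) (by decide) (by decide) (by omega) (by decide)
  · exact exists_closed_walk (b := 4) (L := 6) ((n + 2) / 4 - 1) (by decide) (by decide)
      (by decide) (by decide) (by decide) (by decide) (by omega) (by decide)
  · exact exists_closed_walk (b := 10) (L := 7) ((n + 2) / 4 - 1) (by decide) (by decide)
      (by decide) (by decide) (by decide) (by decide) (by omega) (by decide)

theorem exists_isStarColoring_triangle {n : ℕ} (hn : 4 ≤ n + 2) (hn5 : n + 2 ≠ 5) :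
    ∃ c : Fin 3 × Fin (n + 2) → Fin 5, IsStarColoring
      ((SimpleGraph.cycleGraph 3).boxProd (SimpleGraph.cycleGraph (n + 2))) c := by
  obtain ⟨z, hzN, hz⟩ := exists_closed_walk_triangle hn hn5
  exact ⟨_, locallyStar_triangleRows.isStarColoring locallyStar_triangleRows_swap
    (m := 1) (w := Fin.val) (fun i => i.2) (by decide) hzN hz⟩

theorem exists_isStarColoring_square {m n : ℕ} (hm : 4 ≤ m + 2) (hn : 4 ≤ n + 2) :
    ∃ c : Fin (m + 2) × Fin (n + 2) → Fin 5, IsStarColoring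
      ((SimpleGraph.cycleGraph (m + 2)).boxProd (SimpleGraph.cycleGraph (n + 2))) c := by
  obtain ⟨w, hwM, hw⟩ := exists_closed_walk_square hm
  obtain ⟨z, hzN, hz⟩ := exists_closed_walk_square hn
  exact ⟨_, locallyStar_squareRows.isStarColoring locallyStar_squareRows_swap hwM hw hzN hz⟩

/-- For `m, n ≥ 3`, except `(m, n) = (3, 3), (3, 5), (5, 3)`, the star chromatic
number of `Cm □ Cn` equals 5. -/
theorem starChromatic_Cm_Cn_eq_five (m n : ℕ) (hm : 3 ≤ m) (hn : 3 ≤ n)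
    (h33 : ¬ (m = 3 ∧ n = 3)) (h35 : ¬ (m = 3 ∧ n = 5)) (h53 : ¬ (m = 5 ∧ n = 3)) :
    (∃ c : Fin m × Fin n → Fin 5,
      IsStarColoring ((SimpleGraph.cycleGraph m).boxProd (SimpleGraph.cycleGraph n)) c) ∧
    (∀ k : ℕ, (∃ c : Fin m × Fin n → Fin k,
      IsStarColoring ((SimpleGraph.cycleGraph m).boxProd (SimpleGraph.cycleGraph n)) c) →
      5 ≤ k) := by
  obtain ⟨m, rfl⟩ := Nat.exists_eq_add_of_le' hm
  obtain ⟨n, rfl⟩ := Nat.exists_eq_add_of_le' hn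
  refine ⟨?_, fun k ⟨c, h⟩ => h.five_le⟩
  rcases Nat.eq_zero_or_pos m with rfl | hm'
  · exact exists_isStarColoring_triangle (n := n + 1) (by omega) (by omega)
  rcases Nat.eq_zero_or_pos n with rfl | hn'
  · obtain ⟨c, h⟩ := exists_isStarColoring_triangle (n := m + 1) (by omega) (by omega)
    exact ⟨_, h.comp_iso (SimpleGraph.boxProdComm _ _)⟩
  · exact exists_isStarColoring_square (m := m + 1) (n := n + 1) (by omega) (by omega)
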